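/- For every n ≥ 1, let μ_k = (1/b_n)·Σ_{V(T)=n} (J(T) − (n−1)/2)^k ∈ ℚ be the k-th central moment of the number-of-jumps statistic over the uniform distribution on full binary trees with n internal vertices. Then μ_6·(4n⁶ − 16n⁵ + 7n⁴ + 32n³ − 26n² − 16n + 15) = μ_2³·(60n⁶ − 300n⁵ + 391n⁴ − 20n³ − 82n² − 16n + 15); equivalently, whenever μ_2 ≠ 0, the scaled sixth central moment μ_6/μ_2³ equals (60n⁶ − 300n⁵ + 391n⁴ − 20n³ − 82n² − 16n + 15)/(4n⁶ − 16n⁵ + 7n⁴ + 32n³ − 26n² − 16n + 15). -/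

import Mathlib

inductive BTree : Type
  | leaf : BTree
  | node : BTree → BTree → BTree

namespace BTree

/-- number of internal vertices -/
def V : BTree → ℕ
  | leaf => 0
  | node l r => V l + V r + 1

/-- depth of the rightmost leaf -/
def D : BTree → ℕ
  | leaf => 0
  | node _ r => 1 + D r

/-- number of jumps -/
def J : BTree → ℕ
  | leaf => 0
  | node leaf r => J r
  | node (node l₁ r₁) r => J (node l₁ r₁) + J r + 1

/-- sum of jump distances -/
def JD : BTree → ℕ
  | leaf => 0
  | node l r => JD l + JD r + D l

end BTree

open Polynomial in
noncomputable def jL (f : ℕ → ℚ) : ℚ[X] →ₗ[ℚ] ℚ :=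
  Polynomial.lsum (fun k => f k • (LinearMap.id : ℚ →ₗ[ℚ] ℚ))

open Polynomial in
lemma jL_X_pow (f : ℕ → ℚ) (k : ℕ) : jL f (X ^ k) = f k := by
  simp [jL, Polynomial.lsum_apply, ← Polynomial.monomial_one_right_eq_X_pow,
    Polynomial.sum_monomial_index]

namespace BTree

lemma V_eq_zero {T : BTree} (h : T.V = 0) : T = leaf := by
  cases T with
  | leaf => rfl
  | node l r => simp [V] at h

lemma finite_V (n : ℕ) : {T : BTree | T.V = n}.Finite := by
  induction n using Nat.strong_induction_on with
  | _ n ih =>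
    have h : {T : BTree | T.V < n}.Finite := by
      have : {T : BTree | T.V < n} = ⋃ i ∈ Set.Iio n, {T : BTree | T.V = i} := by
        ext T; simp
      rw [this]
      exact (Set.finite_Iio n).biUnion (fun i hi => ih i hi)
    refine ((h.image2 node h).union (Set.finite_singleton leaf)).subset ?_
    rintro T hT
    cases T with
    | leaf => right; rfl
    | node l r =>
      left
      simp only [V, Set.mem_ofPred_eq] at hT
      exact ⟨l, by simp; omega, r, by simp; omega, rfl⟩

noncomputable def trees (n : ℕ) : Finset BTree := (finite_V n).toFinset

lemma mem_trees {n : ℕ} {T : BTree} : T ∈ trees n ↔ T.V = n := by simp [trees]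

lemma trees_zero : trees 0 = {leaf} := by
  ext T
  simp only [mem_trees, Finset.mem_singleton]
  exact ⟨V_eq_zero, fun h => by subst h; rfl⟩

lemma sum_trees_succ {M : Type*} [AddCommMonoid M] (n : ℕ) (f : BTree → M) :
    ∑ T ∈ trees (n + 1), f T =
      ∑ ij ∈ Finset.HasAntidiagonal.antidiagonal n, ∑ l ∈ trees ij.1, ∑ r ∈ trees ij.2, f (node l r) := by
  simp_rw [← Finset.sum_product']
  rw [Finset.sum_sigma']
  symm
  refine Finset.sum_bij (fun x _ => node x.2.1 x.2.2) ?_ ?_ ?_ ?_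
  · rintro ⟨⟨i, j⟩, l, r⟩ h
    simp [mem_trees] at h
    simp [mem_trees, V]
    omega
  · rintro ⟨⟨i, j⟩, l, r⟩ h ⟨⟨i', j'⟩, l', r'⟩ h' e
    simp [mem_trees] at h h' e
    obtain ⟨rfl, rfl⟩ := e
    obtain ⟨-, rfl, rfl⟩ := h
    obtain ⟨-, rfl, rfl⟩ := h'
    rfl
  · intro T hT
    rw [mem_trees] at hT
    cases T with
    | leaf => simp [V] at hT
    | node l r =>
      simp [V] at hT
      exact ⟨⟨⟨l.V, r.V⟩, l, r⟩, by simp [mem_trees, hT], rfl⟩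
  · intros; rfl

open Polynomial

noncomputable def N (n : ℕ) : ℚ[X] := ∑ T ∈ trees n, X ^ T.J

lemma N_zero : N 0 = 1 := by simp [N, trees_zero, J]

/-- left-subtree weights -/
noncomputable def NL (n : ℕ) : ℚ[X] := if n = 0 then 1 else X * N n

lemma N_succ (n : ℕ) : N (n + 1) = ∑ ij ∈ Finset.HasAntidiagonal.antidiagonal n, NL ij.1 * N ij.2 := by
  rw [N, sum_trees_succ]
  refine Finset.sum_congr rfl ?_
  rintro ⟨i, j⟩ -
  dsimp only
  rw [NL]
  split_ifs with h
  · subst h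
    simp [trees_zero, J, N]
  · rw [N, N, mul_assoc, Finset.sum_mul_sum]
    simp only [Finset.mul_sum]
    refine Finset.sum_congr rfl fun l hl => Finset.sum_congr rfl fun r hr => ?_
    cases l with
    | leaf => simp [mem_trees, V] at hl; omega
    | node a b => simp only [J]; ring

noncomputable def F : PowerSeries ℚ[X] := PowerSeries.mk N

lemma F_eq : F = 1 + (PowerSeries.X : PowerSeries ℚ[X]) * ((1 + (PowerSeries.C (X : ℚ[X])) * (F - 1)) * F) := by
  have h : (1 + (PowerSeries.C (X : ℚ[X])) * (F - 1)) = PowerSeries.mk NL := by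
    ext1 n
    rcases n with _ | n
    · simp [F, NL, N_zero]
    · simp [F, NL, PowerSeries.coeff_C_mul, PowerSeries.coeff_one]
  rw [h]
  ext1 n
  rcases n with _ | n
  · simp [F, N_zero]
  · rw [map_add, PowerSeries.coeff_succ_X_mul, PowerSeries.coeff_mul]
    simp [F, N_succ, PowerSeries.coeff_one]

lemma ode_aux {A : Type*} [CommRing A] (d : Derivation ℤ A A) (y e : A) (h : y ^ 2 = e) :
    2 * (e * d y) = d e * y := by
  subst h
  rw [pow_two, Derivation.leibniz]
  simp only [smul_eq_mul]; ring

noncomputable def Y : PowerSeries ℚ[X] := 2 * (PowerSeries.X : PowerSeries ℚ[X]) * (PowerSeries.C (X : ℚ[X])) * F + ((PowerSeries.X : PowerSeries ℚ[X]) - (PowerSeries.C (X : ℚ[X])) * (PowerSeries.X : PowerSeries ℚ[X]) - 1)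

lemma Y_sq : Y ^ 2 = 1 - 2 * (1 + (PowerSeries.C (X : ℚ[X]))) * (PowerSeries.X : PowerSeries ℚ[X]) + (1 - (PowerSeries.C (X : ℚ[X]))) ^ 2 * (PowerSeries.X : PowerSeries ℚ[X]) ^ 2 := by
  have h := F_eq
  rw [Y]
  linear_combination (-4 * (PowerSeries.X : PowerSeries ℚ[X]) * (PowerSeries.C (X : ℚ[X]))) * h

lemma ode : 2 * ((1 - 2 * (1 + (PowerSeries.C (X : ℚ[X]))) * (PowerSeries.X : PowerSeries ℚ[X]) + (1 - (PowerSeries.C (X : ℚ[X]))) ^ 2 * (PowerSeries.X : PowerSeries ℚ[X]) ^ 2) * PowerSeries.derivative ℚ[X] Y)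
    = (2 * (- (1 + (PowerSeries.C (X : ℚ[X]))) + (1 - (PowerSeries.C (X : ℚ[X]))) ^ 2 * (PowerSeries.X : PowerSeries ℚ[X]))) * Y := by
  have h := congrArg (PowerSeries.derivative ℚ[X]) Y_sq
  have ht : PowerSeries.derivative ℚ[X] (PowerSeries.C (X : ℚ[X])) = 0 := PowerSeries.derivative_C
  have hx : PowerSeries.derivative ℚ[X] (PowerSeries.X : PowerSeries ℚ[X]) = 1 := PowerSeries.derivative_X
  have h1 : PowerSeries.derivative ℚ[X] (1 : PowerSeries ℚ[X]) = 0 := by simp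
  have h2 : PowerSeries.derivative ℚ[X] (2 : PowerSeries ℚ[X]) = 0 := by
    rw [← one_add_one_eq_two, map_add, h1, add_zero]
  simp only [pow_two, map_add, map_sub, Derivation.leibniz, smul_eq_mul, ht, hx, h1, h2] at h
  have hs := Y_sq
  linear_combination (-2 * PowerSeries.derivative ℚ[X] Y) * hs + Y * h

lemma Y_coeff (n : ℕ) : PowerSeries.coeff (n + 2) Y = 2 * X * N (n + 1) := by
  have : Y = (PowerSeries.X : PowerSeries ℚ[X]) * (PowerSeries.C (2 * X : ℚ[X]) * F + PowerSeries.C (1 - X : ℚ[X])) - 1 := by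
    rw [Y]; simp only [map_mul, map_sub, map_ofNat, map_one]; ring
  rw [this, map_sub, PowerSeries.coeff_succ_X_mul]
  simp [F, PowerSeries.coeff_one, mul_assoc]

lemma N_one : N 1 = 1 := by rw [N_succ]; simp [NL, N_zero]
lemma N_two : N 2 = 1 + X := by
  rw [N_succ, Finset.Nat.antidiagonal_succ]; simp [NL, N_zero, N_one]

lemma N_rec (n : ℕ) : ((n : ℚ[X]) + 3) * N (n + 2) =
    (2 * (n : ℚ[X]) + 3) * (1 + X) * N (n + 1) - (n : ℚ[X]) * (1 - X) ^ 2 * N n := by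
  rcases n with _ | n
  · simp [N_two, N_one]
  have h := congrArg (PowerSeries.coeff (n + 3)) ode
  set yd := PowerSeries.derivative ℚ[X] Y with hyd
  have e1 : 2 * ((1 - 2 * (1 + (PowerSeries.C (X : ℚ[X]))) * (PowerSeries.X : PowerSeries ℚ[X]) + (1 - (PowerSeries.C (X : ℚ[X]))) ^ 2 * (PowerSeries.X : PowerSeries ℚ[X]) ^ 2) * yd) =
      PowerSeries.C (2 : ℚ[X]) * yd - PowerSeries.C (4 * (1 + X) : ℚ[X]) * ((PowerSeries.X : PowerSeries ℚ[X]) * yd)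
        + PowerSeries.C (2 * (1 - X) ^ 2 : ℚ[X]) * ((PowerSeries.X : PowerSeries ℚ[X]) * ((PowerSeries.X : PowerSeries ℚ[X]) * yd)) := by
    simp only [map_mul, map_sub, map_add, map_ofNat, map_one, map_pow]; ring
  have e2 : (2 * (- (1 + (PowerSeries.C (X : ℚ[X]))) + (1 - (PowerSeries.C (X : ℚ[X]))) ^ 2 * (PowerSeries.X : PowerSeries ℚ[X]))) * Y =
      PowerSeries.C (2 * (1 - X) ^ 2 : ℚ[X]) * ((PowerSeries.X : PowerSeries ℚ[X]) * Y)
       - PowerSeries.C (2 * (1 + X) : ℚ[X]) * Y := by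
    simp only [map_mul, map_sub, map_add, map_ofNat, map_one, map_pow]; ring
  rw [e1, e2] at h
  simp only [map_add, map_sub, PowerSeries.coeff_C_mul, PowerSeries.coeff_succ_X_mul] at h
  simp only [hyd, PowerSeries.coeff_derivative, Y_coeff] at h
  have hX : (4 * X : ℚ[X]) ≠ 0 := by simp
  apply mul_left_cancel₀ hX
  push_cast at h ⊢
  linear_combination h

noncomputable def m (k n : ℕ) : ℚ := ∑ T ∈ trees n, ((T.J : ℚ) - ((n : ℚ) - 1) / 2) ^ k

lemma L_rec (f : ℕ → ℚ) (n : ℕ) : ((n : ℚ) + 3) * ∑ T ∈ trees (n + 2), f T.J =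
    (2 * n + 3) * ∑ T ∈ trees (n + 1), (f T.J + f (T.J + 1))
      - n * ∑ T ∈ trees n, (f T.J - 2 * f (T.J + 1) + f (T.J + 2)) := by
  have h0 : ((n : ℚ) + 3) • N (n + 2) =
    (2 * n + 3 : ℚ) • (N (n + 1) + X * N (n + 1))
      - (n : ℚ) • (N n - (2 : ℚ) • (X * N n) + X ^ 2 * N n) := by
    have := N_rec n
    simp only [Polynomial.smul_eq_C_mul, map_add, map_mul, map_natCast, map_ofNat]
    linear_combination this
  have h := congrArg (jL f) h0
  simp only [map_smul, map_add, map_sub, N, Finset.mul_sum, map_sum, ← pow_succ', ← pow_add,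
    jL_X_pow, smul_eq_mul] at h
  simp only [Finset.sum_add_distrib, Finset.sum_sub_distrib, ← Finset.mul_sum]
  simp only [← Finset.mul_sum, add_comm 2] at h
  exact h

lemma m_rec (k n : ℕ) : ((n : ℚ) + 3) * m k (n + 2) =
    (2 * n + 3) * ∑ T ∈ trees (n + 1), ((((T.J : ℚ) - (((n + 1 : ℕ) : ℚ) - 1) / 2) - 1/2) ^ k
        + (((T.J : ℚ) - (((n + 1 : ℕ) : ℚ) - 1) / 2) + 1/2) ^ k)
      - n * ∑ T ∈ trees n, ((((T.J : ℚ) - ((n : ℚ) - 1) / 2) - 1) ^ k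
        - 2 * ((T.J : ℚ) - ((n : ℚ) - 1) / 2) ^ k + (((T.J : ℚ) - ((n : ℚ) - 1) / 2) + 1) ^ k) := by
  rw [m, L_rec (fun j => ((j : ℚ) - (((n + 2 : ℕ) : ℚ) - 1) / 2) ^ k)]
  congr 2 <;>
  · refine Finset.sum_congr rfl fun T _ => ?_
    push_cast
    congr 1
    · ring_nf
    · ring_nf

lemma m0_rec (n : ℕ) : ((n : ℚ) + 3) * m 0 (n + 2) = 2 * (2 * n + 3) * m 0 (n + 1) := by
  rw [m_rec]; simp only [m, pow_zero, Finset.sum_const, nsmul_eq_mul]; ring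

lemma m2_rec (n : ℕ) : ((n : ℚ) + 3) * m 2 (n + 2) =
    (2 * n + 3) * (2 * m 2 (n + 1) + 1/2 * m 0 (n + 1)) - n * (2 * m 0 n) := by
  rw [m_rec]; simp only [m, Finset.mul_sum, ← Finset.sum_add_distrib]
  congr 1 <;> refine Finset.sum_congr rfl fun T _ => ?_ <;> ring

lemma m4_rec (n : ℕ) : ((n : ℚ) + 3) * m 4 (n + 2) =
    (2 * n + 3) * (2 * m 4 (n + 1) + 3 * m 2 (n + 1) + 1/8 * m 0 (n + 1))
      - n * (12 * m 2 n + 2 * m 0 n) := by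
  rw [m_rec]; simp only [m, Finset.mul_sum, ← Finset.sum_add_distrib]
  congr 1 <;> refine Finset.sum_congr rfl fun T _ => ?_ <;> ring

lemma m6_rec (n : ℕ) : ((n : ℚ) + 3) * m 6 (n + 2) =
    (2 * n + 3) * (2 * m 6 (n + 1) + 15/2 * m 4 (n + 1) + 15/8 * m 2 (n + 1)
        + 1/32 * m 0 (n + 1))
      - n * (30 * m 4 n + 30 * m 2 n + 2 * m 0 n) := by
  rw [m_rec]; simp only [m, Finset.mul_sum, ← Finset.sum_add_distrib]
  congr 1 <;> refine Finset.sum_congr rfl fun T _ => ?_ <;> ring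

lemma L_N (f : ℕ → ℚ) (n : ℕ) : ∑ T ∈ trees n, f T.J = jL f (N n) := by
  simp [N, map_sum, jL_X_pow]

lemma m_one (k : ℕ) : m k 1 = 0 ^ k := by
  rw [m, L_N (fun j => ((j : ℚ) - (((1 : ℕ) : ℚ) - 1) / 2) ^ k), N_one,
    ← pow_zero X, jL_X_pow]
  simp

lemma odd_ne (n : ℕ) (c : ℤ) : (2 * (n : ℚ) + (2 * c + 1)) ≠ 0 := by
  have : (2 * (n : ℤ) + (2 * c + 1)) ≠ 0 := by omega
  exact_mod_cast this

lemma closed (n : ℕ) (hn : 1 ≤ n) : 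
    m 0 n ≠ 0 ∧
    m 2 n = ((n : ℚ) ^ 2 - 1) / (4 * (2 * n - 1)) * m 0 n ∧
    m 4 n = ((n : ℚ) ^ 2 - 1) * (3 * n ^ 2 - 4 * n - 3) / (16 * (2 * n - 1) * (2 * n - 3)) * m 0 n ∧
    m 6 n = ((n : ℚ) ^ 2 - 1) * (15 * n ^ 4 - 60 * n ^ 3 + 34 * n ^ 2 + 44 * n + 15)
      / (64 * (2 * n - 1) * (2 * n - 3) * (2 * n - 5)) * m 0 n := by
  induction n using Nat.strong_induction_on with
  | _ n ih =>
  rcases n with _ | _ | n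
  · omega
  · simp [m_one]
  have a1 := odd_ne n 0
  have a2 := odd_ne n 1
  have a3 := odd_ne n (-1)
  have a4 := odd_ne n (-2)
  have a5 := odd_ne n (-3)
  have hp : (n : ℚ) + 3 ≠ 0 := by positivity
  have hp2 : (n : ℚ) + 2 ≠ 0 := by positivity
  obtain ⟨i0, i2, i4, i6⟩ := ih (n + 1) (by omega) (by omega)
  have r0 := m0_rec n
  have r2 := m2_rec n
  have r4 := m4_rec n
  have r6 := m6_rec n
  rcases n with _ | n
  · simp [m_one] at r0 r2 r4 r6 ⊢
    refine ⟨?_, ?_, ?_, ?_⟩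
    · intro h; rw [h] at r0; norm_num at r0
    all_goals norm_num at r0 r2 r4 r6 ⊢; linarith
  obtain ⟨j0, j2, j4, j6⟩ := ih (n + 1) (by omega) (by omega)
  have s0 := m0_rec n
  have hp4 : (n : ℚ) + 4 ≠ 0 := by positivity
  have hq : (n : ℚ) + 3 ≠ 0 := by positivity
  have b3 := odd_ne n 0
  have b4 := odd_ne n 1
  have b5 := odd_ne n 2
  have b6 := odd_ne n (-1)
  have b7 := odd_ne n (-2)
  norm_num at b3 b4 b5 b6 b7
  have c6 : 2 * (n : ℚ) - 1 ≠ 0 := by rwa [sub_eq_add_neg]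
  have c7 : 2 * (n : ℚ) - 3 ≠ 0 := by rwa [sub_eq_add_neg]
  clear ih a1 a2 a3 a4 a5 hp hp2
  simp only [show n + 1 + 2 = n + 3 from rfl, show n + 1 + 1 = n + 2 from rfl] at *
  push_cast at *
  generalize m 0 (n + 1) = u0 at *
  generalize m 0 (n + 2) = v0 at *
  generalize m 0 (n + 3) = w0 at *
  generalize m 2 (n + 1) = u2 at *
  generalize m 2 (n + 2) = v2 at *
  generalize m 2 (n + 3) = w2 at *
  generalize m 4 (n + 1) = u4 at *
  generalize m 4 (n + 2) = v4 at *
  generalize m 4 (n + 3) = w4 at *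
  generalize m 6 (n + 1) = u6 at *
  generalize m 6 (n + 2) = v6 at *
  generalize m 6 (n + 3) = w6 at *
  generalize (n : ℚ) = z at *
  have k0 : v0 = 2 * (2 * z + 3) / (z + 3) * u0 := by
    field_simp; linear_combination s0
  have k1 : w0 = 2 * (2 * z + 5) / (z + 4) * v0 := by
    field_simp; linear_combination r0
  have d1 : 2 * (z + 1) - 1 = 2 * z + 1 := by ring
  have d2 : 2 * (z + 1) - 3 = 2 * z - 1 := by ring
  have d3 : 2 * (z + 1) - 5 = 2 * z - 3 := by ring
  have d4 : 2 * (z + 2) - 1 = 2 * z + 3 := by ring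
  have d5 : 2 * (z + 2) - 3 = 2 * z + 1 := by ring
  have d6 : 2 * (z + 2) - 5 = 2 * z - 1 := by ring
  have d7 : 2 * (z + 3) - 1 = 2 * z + 5 := by ring
  have d8 : 2 * (z + 3) - 3 = 2 * z + 3 := by ring
  have d9 : 2 * (z + 3) - 5 = 2 * z + 1 := by ring
  have n1 : z + 1 + 1 = z + 2 := by ring
  have n2 : z + 1 + 2 = z + 3 := by ring
  have n3 : z + 1 + 3 = z + 4 := by ring
  simp only [n1, n2, n3, d1, d2, d3, d4, d5, d6, d7, d8, d9] at *
  have l2 : w2 = ((2 * (z + 1) + 3) * (2 * v2 + 1/2 * v0) - (z + 1) * (2 * u0)) / (z + 4) := by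
    rw [eq_div_iff hp4]; linear_combination r2
  have l4 : w4 = ((2 * (z + 1) + 3) * (2 * v4 + 3 * v2 + 1/8 * v0)
      - (z + 1) * (12 * u2 + 2 * u0)) / (z + 4) := by
    rw [eq_div_iff hp4]; linear_combination r4
  have l6 : w6 = ((2 * (z + 1) + 3) * (2 * v6 + 15/2 * v4 + 15/8 * v2 + 1/32 * v0)
      - (z + 1) * (30 * u4 + 30 * u2 + 2 * u0)) / (z + 4) := by
    rw [eq_div_iff hp4]; linear_combination r6
  clear r0 r2 r4 r6 s0
  refine ⟨?_, ?_, ?_, ?_⟩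
  · rw [k1]
    exact mul_ne_zero (div_ne_zero (mul_ne_zero two_ne_zero b5) hp4) i0
  · rw [l2, i2, k1, k0]; field_simp; ring
  · rw [l4, i4, i2, j2, k1, k0]; field_simp; ring
  · rw [l6, i6, i4, i2, j4, j2, k1, k0]; field_simp; ring

end BTree

/-- The scaled sixth central moment of the number-of-jumps statistic over full
binary trees with n ≥ 1 internal vertices:
μ₆·(4n⁶ − 16n⁵ + 7n⁴ + 32n³ − 26n² − 16n + 15)
  = μ₂³·(60n⁶ − 300n⁵ + 391n⁴ − 20n³ − 82n² − 16n + 15). -/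
theorem stmt_12 (n : ℕ) (hn : 1 ≤ n)
    (μ : ℕ → ℚ)
    (hμ : ∀ k, μ k =
      (∑ᶠ T ∈ {T : BTree | T.V = n}, ((T.J : ℚ) - ((n : ℚ) - 1) / 2) ^ k) /
        (Nat.card {T : BTree // T.V = n} : ℚ)) :
    μ 6 * (4 * (n : ℚ) ^ 6 - 16 * n ^ 5 + 7 * n ^ 4 + 32 * n ^ 3 - 26 * n ^ 2 - 16 * n + 15) =
      (μ 2) ^ 3 *
        (60 * (n : ℚ) ^ 6 - 300 * n ^ 5 + 391 * n ^ 4 - 20 * n ^ 3 - 82 * n ^ 2 - 16 * n + 15) := by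
  have hs : ∀ k, (∑ᶠ T ∈ {T : BTree | T.V = n}, ((T.J : ℚ) - ((n : ℚ) - 1) / 2) ^ k) =
      BTree.m k n := by
    intro k
    rw [finsum_mem_eq_finite_toFinset_sum _ (BTree.finite_V n)]
    rfl
  have hc : (Nat.card {T : BTree // T.V = n} : ℚ) = BTree.m 0 n := by
    have : Nat.card {T : BTree // T.V = n} = (BTree.trees n).card := by
      rw [BTree.trees, ← Set.ncard_eq_toFinset_card _ (BTree.finite_V n)]
      rfl
    rw [this]
    simp [BTree.m]
  obtain ⟨h0, h2, h4, h6⟩ := BTree.closed n hn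
  have e2 : μ 2 = ((n : ℚ) ^ 2 - 1) / (4 * (2 * n - 1)) := by
    rw [hμ, hs, hc, h2]; field_simp
  have e6 : μ 6 = ((n : ℚ) ^ 2 - 1) * (15 * n ^ 4 - 60 * n ^ 3 + 34 * n ^ 2 + 44 * n + 15)
      / (64 * (2 * n - 1) * (2 * n - 3) * (2 * n - 5)) := by
    rw [hμ, hs, hc, h6]; field_simp
  have a3 := BTree.odd_ne n (-1)
  have a4 := BTree.odd_ne n (-2)
  have a5 := BTree.odd_ne n (-3)
  norm_num [← sub_eq_add_neg] at a3 a4 a5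
  rw [← ne_eq] at a3 a4 a5
  rw [e2, e6]
  generalize (n : ℚ) = z at *
  rw [div_pow, div_mul_eq_mul_div, div_mul_eq_mul_div, div_eq_div_iff
    (by simp [a3, a4, a5]) (by simp [a3])]
  ring
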